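/- arXiv:2410.03766 — 6 statements merged into one kernel-verified Lean document; each statement's English description precedes it below -/
import Mathlib

section
/- Let t ≥ 1, let a, b ∈ ℝ^t, and let t1 ∈ [1, t]. Then for every s ∈ [1, t]: (i) if s ≤ t1 then [a*b]_s = [a_{1:t1} * b_{1:t1}]_s; and (ii) if s > t1 then [a*b]_s = [a_{t1+1:t} * b_{1:t−t1}]_{s−t1} + [FutureFill(a_{1:t1}, b)]_{s−t1}. -/
/-- Convolution of two (ℤ-indexed, one-based) real sequences at position `s`:
`[a*b]_s = ∑_{i=1}^{s} a_i · b_{s+1-i}`. -/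
noncomputable def conv (a b : ℤ → ℝ) (s : ℤ) : ℝ :=
  ∑ i ∈ Finset.Icc 1 s, a i * b (s + 1 - i)

/-- `FutureFill(v, w)` where `v` has length `t1` and `w` has length `t2`:
`[FutureFill(v, w)]_s = ∑_{i=1}^{t2-s} v_{t1-i+1} · w_{s+i}`. -/
noncomputable def futureFill (v w : ℤ → ℝ) (t1 t2 s : ℤ) : ℝ :=
  ∑ i ∈ Finset.Icc 1 (t2 - s), v (t1 - i + 1) * w (s + i)

/-- The subsequence `a_{i:j}` (one-based, of length `j - i + 1`, zero-padded outside). -/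
noncomputable def subseq (a : ℤ → ℝ) (i j : ℤ) : ℤ → ℝ :=
  fun k => if 1 ≤ k ∧ k ≤ j - i + 1 then a (i + k - 1) else 0

/-- Proposition 3.1: splitting a convolution into a convolution of recent parts
plus a FutureFill of the past part. -/
theorem conv_split_futureFill
    (t : ℤ) (ht : 1 ≤ t) (a b : ℤ → ℝ)
    (ha : ∀ j : ℤ, j ≤ 0 ∨ t < j → a j = 0)
    (hb : ∀ j : ℤ, j ≤ 0 ∨ t < j → b j = 0)
    (t1 : ℤ) (ht1 : 1 ≤ t1) (ht1t : t1 ≤ t) :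
    ∀ s : ℤ, 1 ≤ s → s ≤ t →
      (s ≤ t1 → conv a b s = conv (subseq a 1 t1) (subseq b 1 t1) s) ∧
      (t1 < s →
        conv a b s =
          conv (subseq a (t1 + 1) t) (subseq b 1 (t - t1)) (s - t1) +
            futureFill (subseq a 1 t1) b t1 t (s - t1)) := by
  intro s hs hst
  constructor
  · intro hs1
    refine Finset.sum_congr rfl fun i hi => ?_
    rw [Finset.mem_Icc] at hi
    simp only [subseq]
    rw [if_pos (by omega), if_pos (by omega)]
    congr 2 <;> ring
  · intro hs1
    have hsplit : Finset.Icc 1 s = Finset.Icc (t1 + 1) s ∪ Finset.Icc 1 t1 := by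
      ext i
      simp only [Finset.mem_union, Finset.mem_Icc]
      omega
    have hdisj : Disjoint (Finset.Icc (t1 + 1) s) (Finset.Icc 1 t1) := by
      rw [Finset.disjoint_left]
      intro i
      simp only [Finset.mem_Icc]
      omega
    unfold conv futureFill
    rw [hsplit, Finset.sum_union hdisj]
    congr 1
    · refine Finset.sum_nbij' (fun i => i - t1) (fun k => k + t1) ?_ ?_ ?_ ?_ ?_
      · intro i hi
        simp only [Finset.mem_Icc] at hi ⊢
        omega
      · intro k hk
        simp only [Finset.mem_Icc] at hk ⊢
        omega
      · intro i _
        ring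
      · intro k _
        ring
      · intro i hi
        rw [Finset.mem_Icc] at hi
        simp only [subseq]
        rw [if_pos (by omega), if_pos (by omega)]
        congr 2 <;> ring
    · have hsub : Finset.Icc 1 t1 ⊆ Finset.Icc 1 (t - (s - t1)) :=
        Finset.Icc_subset_Icc_right (by omega)
      rw [← Finset.sum_subset hsub]
      · refine Finset.sum_nbij' (fun i => t1 - i + 1) (fun j => t1 - j + 1) ?_ ?_ ?_ ?_ ?_
        · intro i hi
          simp only [Finset.mem_Icc] at hi ⊢
          omega
        · intro j hj
          simp only [Finset.mem_Icc] at hj ⊢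
          omega
        · intro i _
          ring
        · intro j _
          ring
        · intro i hi
          rw [Finset.mem_Icc] at hi
          simp only [subseq]
          rw [if_pos (by omega)]
          congr 2 <;> ring
      · intro j hj hj'
        rw [Finset.mem_Icc] at hj hj'
        simp only [subseq]
        rw [if_neg (by omega), zero_mul]
end

section
/- Correctness of Epoched-FutureFill (Theorem 3.1, correctness part): Let u, φ ∈ ℝ^L (with zero-padding conventions), let K ≥ 1, and let t ∈ [1, L], τ ∈ [1, min(t−1, K)] with t' = t − τ ≥ 1. Then the output of Algorithm 1 at time t, namely ŷ_t = Σ_{j=1}^{τ} u_{t+1−j} · φ_j + [FutureFill(u_{1:t'}, φ_{1:t'+K})]_τ, satisfies ŷ_t = [u*φ]_t. -/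
theorem conv_eq_sum_reflect (a b : ℤ → ℝ) (s : ℤ) :
    conv a b s = ∑ j ∈ Finset.Icc 1 s, a (s + 1 - j) * b j := by
  unfold conv
  refine Finset.sum_nbij' (fun i => s + 1 - i) (fun j => s + 1 - j) ?_ ?_ ?_ ?_ ?_
  · intro i hi
    simp only [Finset.mem_Icc] at hi ⊢
    omega
  · intro j hj
    simp only [Finset.mem_Icc] at hj ⊢
    omega
  · intro i _
    ring
  · intro j _
    ring
  · intro i _
    simp only [sub_sub_cancel]

/-- If `m + n` is at most the length of the second prefix, the prefix truncations only cut the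
`FutureFill` sum down to the terms `n < j ≤ m + n` of the convolution at `m + n`. -/
theorem futureFill_subseq_eq_sum (a b : ℤ → ℝ) {m n p : ℤ} (hn : 0 ≤ n) (hp : m + n ≤ p) :
    futureFill (subseq a 1 m) (subseq b 1 p) m p n =
      ∑ j ∈ Finset.Icc (n + 1) (m + n), a (m + n + 1 - j) * b j := by
  unfold futureFill
  rw [← Finset.sum_subset (s₁ := Finset.Icc 1 m)]
  · refine Finset.sum_nbij' (fun i => n + i) (fun j => j - n) ?_ ?_ ?_ ?_ ?_
    · intro i hi
      simp only [Finset.mem_Icc] at hi ⊢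
      omega
    · intro j hj
      simp only [Finset.mem_Icc] at hj ⊢
      omega
    · intro i _
      ring
    · intro j _
      ring
    · intro i hi
      rw [Finset.mem_Icc] at hi
      unfold subseq
      rw [if_pos (by omega), if_pos (by omega)]
      congr 2 <;> ring
  · exact Finset.Icc_subset_Icc le_rfl (by omega)
  · intro i hi hi'
    rw [Finset.mem_Icc] at hi hi'
    unfold subseq
    rw [if_neg (by omega), zero_mul]

/-- Correctness of Epoched-FutureFill (Theorem 3.1, correctness part): with `t' = t - τ`,
`ŷ_t = ∑_{j=1}^{τ} u_{t+1−j} · φ_j + [FutureFill(u_{1:t'}, φ_{1:t'+K})]_τ = [u*φ]_t`. -/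
theorem epochedFutureFill_correct
    (L : ℤ) (hL : 1 ≤ L) (u φ : ℤ → ℝ)
    (hu : ∀ j : ℤ, j ≤ 0 ∨ L < j → u j = 0)
    (hφ : ∀ j : ℤ, j ≤ 0 ∨ L < j → φ j = 0)
    (K : ℤ) (hK : 1 ≤ K)
    (t τ : ℤ) (ht1 : 1 ≤ t) (htL : t ≤ L)
    (hτ1 : 1 ≤ τ) (hτ2 : τ ≤ min (t - 1) K) :
    (∑ j ∈ Finset.Icc 1 τ, u (t + 1 - j) * φ j) +
        futureFill (subseq u 1 (t - τ)) (subseq φ 1 (t - τ + K)) (t - τ) (t - τ + K) τ =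
      conv u φ t := by
  have hτt : τ ≤ t - 1 := hτ2.trans (min_le_left _ _)
  have hτK : τ ≤ K := hτ2.trans (min_le_right _ _)
  rw [conv_eq_sum_reflect, futureFill_subseq_eq_sum u φ (by omega) (by omega), sub_add_cancel,
    ← Finset.sum_union]
  · congr 1
    ext j
    simp only [Finset.mem_union, Finset.mem_Icc]
    omega
  · rw [Finset.disjoint_left]
    intro j hj hj'
    rw [Finset.mem_Icc] at hj hj'
    omega
end

section
/- Runtime bound of Continuous-FutureFill (Theorem 3.2, runtime part): For every integer b ≥ 1, with L = 2^b, one has Σ_{t=1}^{L} max(1, ν₂(t)) · 2^{ν₂(t)} ≤ 3 · L · b². -/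
theorem padicValNat_pow_add_of_lt {p b s : ℕ} [hp : Fact p.Prime] (hs : s ≠ 0) (h : s < p ^ b) :
    padicValNat p (p ^ b + s) = padicValNat p s := by
  have hdvd {k : ℕ} (hk : k ≤ b) : k ≤ padicValNat p (p ^ b + s) ↔ k ≤ padicValNat p s := by
    rw [← padicValNat_dvd_iff_le (by omega), ← padicValNat_dvd_iff_le hs]
    exact Nat.dvd_add_right (pow_dvd_pow p hk)
  have hlt : padicValNat p s < b := by
    by_contra! hle
    exact absurd (Nat.le_of_dvd (Nat.pos_of_ne_zero hs) ((padicValNat_dvd_iff_le hs).2 hle))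
      (not_le.2 h)
  have h₁ := hdvd (k := padicValNat p s) hlt.le
  have h₂ := hdvd (k := padicValNat p s + 1) hlt
  omega

theorem sum_range_two_pow_max_one_padicValNat_le (b : ℕ) :
    ∑ t ∈ Finset.range (2 ^ b), max 1 (padicValNat 2 t) * 2 ^ padicValNat 2 t ≤
      2 ^ b * (b ^ 2 + 1) := by
  induction b with
  | zero => simp
  | succ b ih =>
    have hterm : ∀ s ∈ Finset.range (2 ^ b),
        max 1 (padicValNat 2 (2 ^ b + s)) * 2 ^ padicValNat 2 (2 ^ b + s) ≤
          max 1 (padicValNat 2 s) * 2 ^ padicValNat 2 s +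
            if s = 0 then (b + 1) * 2 ^ b else 0 := by
      intro s hs
      by_cases h0 : s = 0
      · subst h0
        have : max 1 b ≤ b + 1 := by omega
        simpa using (Nat.mul_le_mul_right (2 ^ b) this).trans (Nat.le_add_left _ 1)
      · simp [padicValNat_pow_add_of_lt h0 (Finset.mem_range.1 hs), h0]
    have hsum := Finset.sum_le_sum hterm
    rw [Finset.sum_add_distrib, Finset.sum_ite_eq' (Finset.range (2 ^ b)) 0,
      if_pos (by simp)] at hsum
    rw [pow_succ, mul_two, Finset.sum_range_add]
    linarith [Nat.zero_le (2 ^ b), Nat.zero_le (2 ^ b * b)]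

/-- Runtime bound of Continuous-FutureFill (Theorem 3.2, runtime part):
with `L = 2^b`, `∑_{t=1}^{L} max(1, ν₂(t)) · 2^{ν₂(t)} ≤ 3·L·b²`. -/
theorem continuousFutureFill_runtime (b : ℕ) (hb : 1 ≤ b) :
    ∑ t ∈ Finset.Icc 1 (2 ^ b), max 1 (padicValNat 2 t) * 2 ^ padicValNat 2 t ≤
      3 * 2 ^ b * b ^ 2 := by
  have hsub : Finset.Icc 1 (2 ^ b) ⊆ Finset.range (2 ^ b + 1) := by
    intro t ht
    simp only [Finset.mem_Icc, Finset.mem_range] at ht ⊢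
    omega
  refine (Finset.sum_le_sum_of_subset hsub).trans ?_
  rw [Finset.sum_range_succ, padicValNat.prime_pow, max_eq_right hb]
  calc _ ≤ 2 ^ b * (b ^ 2 + 1) + b * 2 ^ b := by
        gcongr
        exact sum_range_two_pow_max_one_padicValNat_le b
    _ = 2 ^ b * (b ^ 2 + 1 + b) := by ring
    _ ≤ 2 ^ b * (3 * b ^ 2) := by
        gcongr
        nlinarith
    _ = 3 * 2 ^ b * b ^ 2 := by ring
end

section
/- Characterization of cache updates in Continuous-FutureFill (Lemma C.1, combinatorial core): Let i and t be positive integers with t ≤ i, and let ν = ν₂(t). Then i + 1 ≤ t + 2^{ν} if and only if t = 2^{ν} · ⌊i / 2^{ν}⌋; equivalently, the cache entry C_{i+1} is updated at time t in Algorithm 2 (i.e., i+1 ∈ [t+1, t + 2^{ν₂(t)}]) exactly when t is a cumulant of i. -/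
/-- Characterization of cache updates in Continuous-FutureFill (Lemma C.1,
combinatorial core): for positive integers `t ≤ i` with `ν = ν₂(t)`,
`i + 1 ≤ t + 2^ν` iff `t = 2^ν · ⌊i / 2^ν⌋`, i.e. iff `t` is a cumulant of `i`. -/
theorem cache_update_iff_cumulant (i t : ℕ) (hi : 1 ≤ i) (ht : 1 ≤ t) (hti : t ≤ i) :
    i + 1 ≤ t + 2 ^ padicValNat 2 t ↔
      t = 2 ^ padicValNat 2 t * (i / 2 ^ padicValNat 2 t) := by
  obtain ⟨k, hk⟩ : 2 ^ padicValNat 2 t ∣ t := pow_padicValNat_dvd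
  have hd : 0 < 2 ^ padicValNat 2 t := by positivity
  generalize 2 ^ padicValNat 2 t = d at hk hd ⊢
  subst hk
  constructor
  · intro h
    congr 1
    exact (Nat.div_eq_of_lt_le (by linarith) (by linarith)).symm
  · intro h
    rw [h]
    exact Nat.lt_mul_div_succ i hd
end

section
/- Correctness of Continuous-FutureFill (Theorem 3.2, correctness part): Let u and φ be real sequences (indexed from 1, zero-padded outside their support), and let i ≥ 1 be an integer with binary set-bit positions i_1 > i_2 > … > i_m and cumulants i'_j = Σ_{l=1}^{j} 2^{i_l}. Then (a) for every j ∈ [1, m] and every k ∈ [1, 2^{i_j}], the index i + 1 − i'_j + k lies in [1, 2^{i_j + 1}] (so each contribution is a valid FutureFill entry with filter prefix φ_{1:2^{i_j+1}}); and (b) Σ_{j=1}^{m} Σ_{k=1}^{2^{i_j}} u_{i'_j − k + 1} · φ_{i + 1 − i'_j + k} = Σ_{r=1}^{i} u_r · φ_{i + 2 − r}. Consequently, the output of Algorithm 2 at time i+1, namely ŷ_{i+1} = C_{i+1} + u_{i+1}·φ_1, equals [u*φ]_{i+1}. -/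
/-- Distinct powers of two with exponents below that of index `j` sum to less than `2 ^ e j`. -/
theorem sum_Ioi_two_pow_lt {m : ℕ} {e : Fin m → ℕ} (he : StrictAnti e) (j : Fin m) :
    ∑ l ∈ Finset.Ioi j, 2 ^ e l < 2 ^ e j := by
  rw [← Finset.sum_image (f := fun n => 2 ^ n) he.injective.injOn]
  refine Nat.geomSum_lt le_rfl fun k hk => ?_
  obtain ⟨l, hl, rfl⟩ := Finset.mem_image.1 hk
  exact he (Finset.mem_Ioi.1 hl)

theorem sum_Iic_add_sum_Ioi {m : ℕ} (w : Fin m → ℕ) (j : Fin m) :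
    ∑ l ∈ Finset.Iic j, w l + ∑ l ∈ Finset.Ioi j, w l = ∑ l, w l := by
  rw [← Finset.sum_union (Finset.disjoint_left.2 fun l h₁ h₂ =>
    (Finset.mem_Ioi.1 h₂).not_ge (Finset.mem_Iic.1 h₁))]
  congr 1
  ext l
  simp [le_or_gt]

theorem sum_Icc_add_sum_reflect {M : Type*} [AddCommMonoid M] (g : ℤ → M) (N w : ℕ) :
    ∑ r ∈ Finset.Icc (1 : ℤ) N, g r + ∑ k ∈ Finset.Icc (1 : ℤ) w, g ((N + w : ℕ) - k + 1) =
      ∑ r ∈ Finset.Icc (1 : ℤ) (N + w : ℕ), g r := by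
  have reflect : ∑ k ∈ Finset.Icc (1 : ℤ) w, g ((N + w : ℕ) - k + 1) =
      ∑ r ∈ Finset.Ioc (N : ℤ) (N + w : ℕ), g r := by
    refine Finset.sum_nbij' (fun k => ((N + w : ℕ) : ℤ) - k + 1)
      (fun r => ((N + w : ℕ) : ℤ) - r + 1) ?_ ?_ ?_ ?_ ?_ <;>
    simp only [Finset.mem_Icc, Finset.mem_Ioc] <;> intros <;> first | trivial | omega
  rw [reflect, ← Finset.sum_union (Finset.disjoint_left.2 fun r h₁ h₂ => by
    simp only [Finset.mem_Icc, Finset.mem_Ioc] at h₁ h₂; omega)]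
  congr 1
  ext r
  simp only [Finset.mem_union, Finset.mem_Icc, Finset.mem_Ioc]
  omega

/-- Consecutive blocks of lengths `w j`, each read backwards from its right end, tile
`[1, ∑ j, w j]`. -/
theorem sum_blocks_eq_sum_Icc {M : Type*} [AddCommMonoid M] (g : ℤ → M) {m : ℕ}
    (w : Fin m → ℕ) :
    ∑ j, ∑ k ∈ Finset.Icc (1 : ℤ) (w j), g ((∑ l ∈ Finset.Iic j, w l : ℕ) - k + 1) =
      ∑ r ∈ Finset.Icc (1 : ℤ) (∑ j, w j : ℕ), g r := by
  induction m with
  | zero => simp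
  | succ m ih =>
    have hc (j : Fin m) :
        ∑ l ∈ Finset.Iic j.castSucc, w l = ∑ l ∈ Finset.Iic j, w l.castSucc := by
      rw [← Fin.map_castSuccEmb_Iic, Finset.sum_map]
      rfl
    have hl : Finset.Iic (Fin.last m) = Finset.univ := by
      ext l
      simp [Fin.le_last]
    rw [Fin.sum_univ_castSucc]
    simp only [hc, hl]
    rw [ih fun j => w j.castSucc, Fin.sum_univ_castSucc w]
    exact sum_Icc_add_sum_reflect g _ _

/-- Correctness of Continuous-FutureFill (Theorem 3.2, correctness part).
The set-bit positions of `i` are `e 0 > e 1 > … > e (m-1)` (so `i = ∑_j 2^{e j}`),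
and the cumulants are `c j = ∑_{l ≤ j} 2^{e l}`.
(a) Each index `i + 1 − c j + k` for `k ∈ [1, 2^{e j}]` lies in `[1, 2^{e j + 1}]`;
(b) the double sum `∑_j ∑_{k=1}^{2^{e j}} u_{c j − k + 1} · φ_{i+1−c j+k}`
equals `∑_{r=1}^{i} u_r · φ_{i+2−r}`; consequently the algorithm's output
`C_{i+1} + u_{i+1}·φ_1` equals `[u*φ]_{i+1}`. -/
theorem continuousFutureFill_correct
    (u φ : ℤ → ℝ)
    (hu : ∀ j : ℤ, j ≤ 0 → u j = 0) (hφ : ∀ j : ℤ, j ≤ 0 → φ j = 0)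
    (i : ℕ) (hi : 1 ≤ i) (m : ℕ) (e : Fin m → ℕ) (he : StrictAnti e)
    (hie : i = ∑ j : Fin m, 2 ^ e j) :
    (∀ j : Fin m, ∀ k : ℕ, 1 ≤ k → k ≤ 2 ^ e j →
      1 ≤ (i : ℤ) + 1 - ((∑ l ∈ Finset.Iic j, 2 ^ e l : ℕ) : ℤ) + (k : ℤ) ∧
      (i : ℤ) + 1 - ((∑ l ∈ Finset.Iic j, 2 ^ e l : ℕ) : ℤ) + (k : ℤ) ≤ 2 ^ (e j + 1)) ∧
    (∑ j : Fin m, ∑ k ∈ Finset.Icc 1 (2 ^ e j),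
        u (((∑ l ∈ Finset.Iic j, 2 ^ e l : ℕ) : ℤ) - (k : ℤ) + 1) *
          φ ((i : ℤ) + 1 - ((∑ l ∈ Finset.Iic j, 2 ^ e l : ℕ) : ℤ) + (k : ℤ))
      = ∑ r ∈ Finset.Icc (1 : ℤ) (i : ℤ), u r * φ ((i : ℤ) + 2 - r)) ∧
    ((∑ j : Fin m, ∑ k ∈ Finset.Icc 1 (2 ^ e j),
        u (((∑ l ∈ Finset.Iic j, 2 ^ e l : ℕ) : ℤ) - (k : ℤ) + 1) *
          φ ((i : ℤ) + 1 - ((∑ l ∈ Finset.Iic j, 2 ^ e l : ℕ) : ℤ) + (k : ℤ)))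
        + u ((i : ℤ) + 1) * φ 1
      = conv u φ ((i : ℤ) + 1)) := by
  have hsum : (∑ j : Fin m, ∑ k ∈ Finset.Icc 1 (2 ^ e j),
        u (((∑ l ∈ Finset.Iic j, 2 ^ e l : ℕ) : ℤ) - (k : ℤ) + 1) *
          φ ((i : ℤ) + 1 - ((∑ l ∈ Finset.Iic j, 2 ^ e l : ℕ) : ℤ) + (k : ℤ)))
      = ∑ r ∈ Finset.Icc (1 : ℤ) (i : ℤ), u r * φ ((i : ℤ) + 2 - r) := by
    have blocks := sum_blocks_eq_sum_Icc (fun r => u r * φ ((i : ℤ) + 2 - r)) fun j => 2 ^ e j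
    rw [← hie] at blocks
    rw [← blocks]
    refine Finset.sum_congr rfl fun j _ => ?_
    rw [Nat.cast_pow, Nat.cast_ofNat]
    refine Finset.sum_congr rfl fun k _ => ?_
    congr 2
    ring
  refine ⟨fun j k hk₁ hk₂ => ?_, hsum, ?_⟩
  · have hlt := sum_Ioi_two_pow_lt he j
    have hadd := sum_Iic_add_sum_Ioi (fun l => 2 ^ e l) j
    have hpow : (2 : ℤ) ^ (e j + 1) = 2 * (2 ^ e j : ℕ) := by
      push_cast
      ring
    rw [hpow]
    omega
  · rw [hsum, conv]
    have split := sum_Icc_add_sum_reflect (fun r => u r * φ ((i : ℤ) + 2 - r)) i 1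
    simp only [Nat.cast_one, Finset.Icc_self, Finset.sum_singleton, Nat.cast_add] at split
    convert split using 2
    · rw [show (i : ℤ) + 1 - 1 + 1 = i + 1 by ring, show (i : ℤ) + 2 - (i + 1) = 1 by ring]
    · rw [show (i : ℤ) + 1 + 1 = i + 2 by ring]
end

section
/- Correctness of generation from a prompt (Corollary 4.1, correctness part): Let L ≥ 1 and K ≥ 1 be integers, let p ∈ ℝ^L be a prompt, let φ ∈ ℝ^{L+K} be a convolutional filter, and let ŷ ∈ ℝ^K be any sequence. Define u ∈ ℝ^{L+K} as the concatenation u = (p_1, …, p_L, ŷ_1, …, ŷ_K). Then for every t ∈ [1, K]: [u*φ]_{L+t} = [ŷ*φ]_t + [FutureFill(p, φ)]_t. In particular, the auto-regressive convolution output on the concatenated sequence at position L+t decomposes into the online convolution of the generated tokens plus the prefill FutureFill cache of the prompt. -/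
/-- Splitting the convolution of `a` with `b` at position `m + n` after the first `m` terms of `a`. -/
theorem conv_add (a b : ℤ → ℝ) {m n : ℤ} (hm : 0 ≤ m) (hn : 0 ≤ n) :
    conv a b (m + n) =
      conv (fun j => a (m + j)) b n + ∑ i ∈ Finset.Icc 1 m, a i * b (m + n + 1 - i) := by
  have hunion : Finset.Icc 1 (m + n) = Finset.Icc (m + 1) (m + n) ∪ Finset.Icc 1 m := by
    ext i
    simp only [Finset.mem_union, Finset.mem_Icc]
    omega
  have hdisj : Disjoint (Finset.Icc (m + 1) (m + n)) (Finset.Icc 1 m) := by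
    rw [Finset.disjoint_left]
    intro i
    simp only [Finset.mem_Icc]
    omega
  unfold conv
  rw [hunion, Finset.sum_union hdisj]
  congr 1
  refine Finset.sum_bij' (fun i _ => i - m) (fun i _ => m + i) ?_ ?_ ?_ ?_ ?_
  · intro i
    simp only [Finset.mem_Icc]
    omega
  · intro i
    simp only [Finset.mem_Icc]
    omega
  · intro i _
    ring
  · intro i _
    ring
  · intro i _
    congr 2 <;> ring

/-- If `v` vanishes on nonpositive indices and `s + t1 ≤ t2`, then `FutureFill(v, w)` at `s` is the
contribution of the first `t1` terms to the convolution at position `t1 + s`. -/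
theorem futureFill_eq_sum (v w : ℤ → ℝ) {t1 t2 s : ℤ} (hs : t1 + s ≤ t2)
    (hv : ∀ j : ℤ, j ≤ 0 → v j = 0) :
    futureFill v w t1 t2 s = ∑ i ∈ Finset.Icc 1 t1, v i * w (t1 + s + 1 - i) := by
  have hsub : Finset.Icc 1 t1 ⊆ Finset.Icc 1 (t2 - s) :=
    Finset.Icc_subset_Icc_right (by omega)
  unfold futureFill
  rw [← Finset.sum_subset hsub]
  · refine Finset.sum_bij' (fun i _ => t1 - i + 1) (fun i _ => t1 - i + 1) ?_ ?_ ?_ ?_ ?_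
    · intro i
      simp only [Finset.mem_Icc]
      omega
    · intro i
      simp only [Finset.mem_Icc]
      omega
    · intro i _
      ring
    · intro i _
      ring
    · intro i _
      congr 2
      ring
  · intro i hi hi'
    simp only [Finset.mem_Icc] at hi hi'
    rw [hv _ (by omega), zero_mul]

/-- Correctness of generation from a prompt (Corollary 4.1, correctness part):
if `u` is the concatenation of a prompt `p ∈ ℝ^L` with generated tokens `ŷ ∈ ℝ^K`,
and `φ ∈ ℝ^{L+K}`, then for every `t ∈ [1, K]`,
`[u*φ]_{L+t} = [ŷ*φ]_t + [FutureFill(p, φ)]_t` (with `FutureFill` taken with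
`t1 = L`, `t2 = L + K`). -/
theorem generation_from_prompt_correct
    (L K : ℤ) (hL : 1 ≤ L) (hK : 1 ≤ K)
    (p φ yhat u : ℤ → ℝ)
    (hp : ∀ j : ℤ, j ≤ 0 ∨ L < j → p j = 0)
    (hφ : ∀ j : ℤ, j ≤ 0 ∨ L + K < j → φ j = 0)
    (hy : ∀ j : ℤ, j ≤ 0 ∨ K < j → yhat j = 0)
    (hu1 : ∀ j : ℤ, 1 ≤ j → j ≤ L → u j = p j)
    (hu2 : ∀ j : ℤ, 1 ≤ j → j ≤ K → u (L + j) = yhat j)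
    (hu3 : ∀ j : ℤ, j ≤ 0 ∨ L + K < j → u j = 0) :
    ∀ t : ℤ, 1 ≤ t → t ≤ K →
      conv u φ (L + t) = conv yhat φ t + futureFill p φ L (L + K) t := by
  intro t ht htK
  rw [conv_add u φ (by omega) (by omega),
    futureFill_eq_sum p φ (by omega) fun j hj => hp j (Or.inl hj)]
  congr 1
  · refine Finset.sum_congr rfl fun i hi => ?_
    rw [Finset.mem_Icc] at hi
    dsimp only
    rw [hu2 i hi.1 (hi.2.trans htK)]
  · refine Finset.sum_congr rfl fun i hi => ?_
    rw [Finset.mem_Icc] at hi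
    rw [hu1 i hi.1 hi.2]
end
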